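/- For every positive integer n: if n is not divisible by 4 then eo₀(n) = eo₂(n), and if n is divisible by 4 then eo₀(n) > eo₂(n). -/

import Mathlib

/-- A partition is a finite multiset of positive integers. -/
def IsPartition (m : Multiset ℕ) : Prop := ∀ x ∈ m, 0 < x

/-- The largest even part of a partition (0 if there are no even parts). -/
def lep (m : Multiset ℕ) : ℕ := (m.filter (fun x => Even x)).sup

/-- `EO*`: every even part is smaller than every odd part, every part other than the
largest even part appears an even number of times, and the largest even part appears
an odd number of times. -/
def EOStar (m : Multiset ℕ) : Prop :=
  IsPartition m ∧
  (∀ x ∈ m, ∀ y ∈ m, Even x → Odd y → x < y) ∧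
  (∀ x ∈ m, x ≠ lep m → Even (m.count x)) ∧
  (∀ x ∈ m, x = lep m → Odd (m.count x))

/-- `E*`: partitions into even parts where each distinct part appears an even number of times. -/
def EStar (m : Multiset ℕ) : Prop :=
  IsPartition m ∧ (∀ x ∈ m, Even x) ∧ ∀ x : ℕ, Even (m.count x)

/-- `O_k*`: partitions into odd parts with exactly `2k` parts where each distinct part
appears an even number of times. -/
def OStar (k : ℕ) (m : Multiset ℕ) : Prop :=
  IsPartition m ∧ (∀ x ∈ m, Odd x) ∧ Multiset.card m = 2 * k ∧ ∀ x : ℕ, Even (m.count x)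

/-- `Q_{k,r}`: partitions with a `(k+r+1) × k` Durfee rectangle whose largest part below
the rectangle is `< k+r+1`; equivalently, exactly `k` parts are `≥ k+r+1`. -/
def QSet (k r : ℕ) (m : Multiset ℕ) : Prop :=
  IsPartition m ∧ Multiset.card (m.filter (fun x => k + r + 1 ≤ x)) = k

/-- `EO*_{k,r}`: partitions in `EO*` with exactly `2k` odd parts and largest even part `2k+2r`. -/
def EOkr (k r : ℕ) (m : Multiset ℕ) : Prop :=
  EOStar m ∧ Multiset.card (m.filter (fun x => Odd x)) = 2 * k ∧ lep m = 2 * k + 2 * r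

/-- The even-odd crank: largest even part minus the number of odd parts. -/
def eoc (m : Multiset ℕ) : ℤ :=
  (lep m : ℤ) - (Multiset.card (m.filter (fun x => Odd x)) : ℤ)

/-- The conjugate partition: its `i`-th part is the number of parts that are `≥ i`. -/
def conjugate (m : Multiset ℕ) : Multiset ℕ :=
  (Multiset.range m.sup).map (fun i => Multiset.card (m.filter (fun x => i + 1 ≤ x)))

/-- An overpartition: a partition together with a set of overlined part values, which must
be a subset of the distinct part values. -/
def IsOverpartition (p : Multiset ℕ × Finset ℕ) : Prop :=
  IsPartition p.1 ∧ p.2 ⊆ p.1.toFinset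

open PowerSeries

/-- The partitions of `n` all of whose parts satisfy `S`. -/
def partitionsIn (S : ℕ → Prop) (n : ℕ) : Set (Multiset ℕ) :=
  {m | (∀ x ∈ m, 0 < x ∧ S x) ∧ m.sum = n}

/-- The generating function of the partitions all of whose parts satisfy `S`. -/
noncomputable def partitionSeries (S : ℕ → Prop) : PowerSeries ℤ :=
  PowerSeries.mk fun n => ((partitionsIn S n).ncard : ℤ)

/-- The even numbers up to `2 * j` and the odd numbers beyond `2 * j`. -/
def EvenThenOdd (j x : ℕ) : Prop := Even x ↔ x ≤ 2 * j

/-- The first `J` terms of `∑ (-1)^j * X^((2m+1)j) * P_j`, where `P_j` is the generating function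
of the partitions into parts satisfying `EvenThenOdd j`. -/
noncomputable def signedSeries (J m : ℕ) : PowerSeries ℤ :=
  ∑ j ∈ Finset.range J, (-1) ^ j * X ^ ((2 * m + 1) * j) * partitionSeries (EvenThenOdd j)

/-- The multiset with twice each part of `p` repeated and one copy of `2 * j` if `0 < j`. -/
def doubledWithEven (j : ℕ) (p : Multiset ℕ) : Multiset ℕ :=
  2 • p + Multiset.replicate (if j = 0 then 0 else 1) (2 * j)

theorem finite_setOf_isPartition_sum_eq (n : ℕ) :
    {m : Multiset ℕ | IsPartition m ∧ m.sum = n}.Finite := by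
  refine (Set.finite_range (fun p : n.Partition => p.parts)).subset ?_
  rintro m ⟨h, hs⟩
  exact ⟨⟨m, fun {i} hi => h i hi, hs⟩, rfl⟩

theorem partitionsIn_finite (S : ℕ → Prop) (n : ℕ) : (partitionsIn S n).Finite :=
  (finite_setOf_isPartition_sum_eq n).subset fun _ hm => ⟨fun x hx => (hm.1 x hx).1, hm.2⟩

theorem ncard_partitionsIn_of_le {S : ℕ → Prop} {s n : ℕ} (hs : 0 < s) (hS : S s) (hn : s ≤ n) :
    (partitionsIn S n).ncard =
      (partitionsIn (fun x => S x ∧ x ≠ s) n).ncard + (partitionsIn S (n - s)).ncard := by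
  have h : partitionsIn S n =
      partitionsIn (fun x => S x ∧ x ≠ s) n ∪ (s ::ₘ ·) '' partitionsIn S (n - s) := by
    ext m
    simp only [partitionsIn, Set.mem_union, Set.mem_image, Set.mem_ofPred_eq]
    constructor
    · rintro ⟨h1, h2⟩
      by_cases hm : s ∈ m
      · obtain ⟨t, rfl⟩ := Multiset.exists_cons_of_mem hm
        refine Or.inr ⟨t, ⟨fun x hx => h1 x (Multiset.mem_cons_of_mem hx), ?_⟩, rfl⟩
        rw [Multiset.sum_cons] at h2
        omega
      · exact Or.inl ⟨fun x hx => ⟨(h1 x hx).1, (h1 x hx).2, fun e => hm (e ▸ hx)⟩, h2⟩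
    · rintro (⟨h1, h2⟩ | ⟨t, ⟨h1, h2⟩, rfl⟩)
      · exact ⟨fun x hx => ⟨(h1 x hx).1, (h1 x hx).2.1⟩, h2⟩
      · refine ⟨fun x hx => ?_, ?_⟩
        · rcases Multiset.mem_cons.1 hx with rfl | hx
          · exact ⟨hs, hS⟩
          · exact h1 x hx
        · rw [Multiset.sum_cons]
          omega
  rw [h, Set.ncard_union_eq ?_ (partitionsIn_finite _ _) ((partitionsIn_finite _ _).image _),
    Set.ncard_image_of_injective _ fun _ _ => (Multiset.cons_inj_right s).1]
  rw [Set.disjoint_left]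
  rintro _ ⟨h1, -⟩ ⟨t, -, rfl⟩
  exact (h1 s (Multiset.mem_cons_self s t)).2.2 rfl

theorem partitionsIn_congr {S T : ℕ → Prop} {n : ℕ} (h : ∀ x ≤ n, 0 < x → (S x ↔ T x)) :
    partitionsIn S n = partitionsIn T n := by
  ext m
  constructor <;> rintro ⟨h1, h2⟩ <;> refine ⟨fun x hx => ?_, h2⟩ <;>
    have hx' := h x (h2 ▸ Multiset.le_sum_of_mem hx) (h1 x hx).1 <;>
    have := h1 x hx <;> tauto

theorem one_sub_X_pow_mul_partitionSeries {S : ℕ → Prop} {s : ℕ} (hs : 0 < s) (hS : S s) :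
    (1 - X ^ s) * partitionSeries S = partitionSeries (fun x => S x ∧ x ≠ s) := by
  ext n
  rw [sub_mul, one_mul, map_sub, coeff_X_pow_mul']
  simp only [partitionSeries, coeff_mk]
  split_ifs with h
  · rw [ncard_partitionsIn_of_le hs hS h]
    push_cast
    ring
  · rw [sub_zero, partitionsIn_congr]
    intro x hx _
    exact ⟨fun hx' => ⟨hx', by omega⟩, fun hx' => hx'.1⟩

theorem partitionsIn_zero (S : ℕ → Prop) : partitionsIn S 0 = {0} := by
  ext m
  rw [Set.mem_singleton_iff]
  constructor
  · rintro ⟨h1, h2⟩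
    refine Multiset.eq_zero_of_forall_notMem fun x hx => ?_
    have := Multiset.le_sum_of_mem hx
    have := (h1 x hx).1
    omega
  · rintro rfl
    exact ⟨by simp, rfl⟩

theorem X_pow_dvd_partitionSeries_sub_one {S : ℕ → Prop} {K : ℕ} (h : ∀ x, 0 < x → S x → K ≤ x) :
    X ^ K ∣ partitionSeries S - 1 := by
  rw [X_pow_dvd_iff]
  intro n hn
  rw [map_sub, partitionSeries, coeff_mk, coeff_one]
  split_ifs with h0
  · subst h0
    simp [partitionsIn_zero]
  · rw [sub_zero, Nat.cast_eq_zero, Set.ncard_eq_zero (partitionsIn_finite _ _),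
      Set.eq_empty_iff_forall_notMem]
    rintro m ⟨h1, h2⟩
    rcases m.empty_or_exists_mem with rfl | ⟨x, hx⟩
    · simp at h2
      omega
    · have := Multiset.le_sum_of_mem hx
      have := h x (h1 x hx).1 (h1 x hx).2
      omega

theorem one_sub_mul_partitionSeries_evenThenOdd_succ (j : ℕ) :
    (1 - X ^ (2 * (j + 1))) * partitionSeries (EvenThenOdd (j + 1)) =
      (1 - X ^ (2 * j + 1)) * partitionSeries (EvenThenOdd j) := by
  have h₁ : EvenThenOdd (j + 1) (2 * (j + 1)) := by
    simp only [EvenThenOdd, Nat.even_iff]; omega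
  have h₂ : EvenThenOdd j (2 * j + 1) := by
    simp only [EvenThenOdd, Nat.even_iff]; omega
  rw [one_sub_X_pow_mul_partitionSeries (by omega) h₁,
    one_sub_X_pow_mul_partitionSeries (by omega) h₂]
  congr 1
  ext x
  simp only [EvenThenOdd, Nat.even_iff]
  omega

theorem prod_mul_partitionSeries_evenThenOdd_zero (M : ℕ) :
    (∏ m ∈ Finset.range M, (1 - X ^ (2 * m + 1))) * partitionSeries (EvenThenOdd 0) =
      partitionSeries (fun x => EvenThenOdd 0 x ∧ 2 * M ≤ x) := by
  induction M with
  | zero => simp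
  | succ M ih =>
    rw [Finset.prod_range_succ, mul_right_comm, ih, mul_comm,
      one_sub_X_pow_mul_partitionSeries (by omega)
        ⟨by simp only [EvenThenOdd, Nat.even_iff]; omega, by omega⟩]
    unfold partitionSeries
    ext n
    rw [coeff_mk, coeff_mk, partitionsIn_congr]
    intro x _ hx
    simp only [EvenThenOdd, Nat.even_iff]
    omega

theorem signedSeries_functional_equation (J m : ℕ) :
    (1 + X ^ (2 * m + 1)) * signedSeries (J + 1) m -
        (1 + X ^ (2 * m + 2)) * signedSeries (J + 1) (m + 1) =
      (-1) ^ J * X ^ ((2 * m + 1) * (J + 1)) *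
        ((1 - X ^ (2 * J + 1)) * partitionSeries (EvenThenOdd J)) := by
  induction J with
  | zero =>
    simp [signedSeries]
    ring
  | succ J ih =>
    have hr := one_sub_mul_partitionSeries_evenThenOdd_succ J
    unfold signedSeries at ih ⊢
    rw [Finset.sum_range_succ _ (J + 1), Finset.sum_range_succ _ (J + 1)]
    rw [← hr] at ih
    linear_combination ih

theorem X_pow_dvd_prod_mul_signedSeries_sub (J M : ℕ) :
    X ^ J ∣ (∏ m ∈ Finset.range M, (1 + X ^ (2 * m + 1))) * signedSeries J 0 -
      (∏ m ∈ Finset.range M, (1 + X ^ (2 * m + 2))) * signedSeries J M := by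
  induction M with
  | zero => simp
  | succ M ih =>
    rcases J with _ | J
    · simp
    rw [Finset.prod_range_succ, Finset.prod_range_succ]
    have h := signedSeries_functional_equation J M
    have hd : (X : PowerSeries ℤ) ^ (J + 1) ∣ X ^ ((2 * M + 1) * (J + 1)) :=
      pow_dvd_pow _ (Nat.le_mul_of_pos_left _ (by omega))
    have h' := (hd.mul_left ((-1) ^ J)).mul_right
      ((1 - X ^ (2 * J + 1)) * partitionSeries (EvenThenOdd J))
    rw [← h] at h'
    have h₁ := ih.mul_left (1 + X ^ (2 * M + 1))
    have h₂ := h'.mul_left (∏ m ∈ Finset.range M, (1 + X ^ (2 * m + 2)))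
    convert dvd_add h₁ h₂ using 1
    ring

theorem X_pow_dvd_signedSeries_sub (J M : ℕ) (hM : J ≤ M) :
    X ^ J ∣ signedSeries J M - partitionSeries (EvenThenOdd 0) := by
  rcases J with _ | J
  · simp
  rw [signedSeries, Finset.sum_range_succ']
  simp only [pow_zero, mul_zero, one_mul, add_sub_cancel_right]
  refine Finset.dvd_sum fun j _ => ((pow_dvd_pow _ ?_).mul_left _).mul_right _
  nlinarith

theorem X_pow_dvd_prod_mul_signedSeries_sub_prod (J : ℕ) :
    X ^ J ∣ (∏ m ∈ Finset.range J, (1 - X ^ (2 * (2 * m + 1)))) * signedSeries J 0 -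
      ∏ m ∈ Finset.range J, (1 + X ^ (2 * (m + 1))) := by
  have h₁ := (X_pow_dvd_prod_mul_signedSeries_sub J J).mul_left
    (∏ m ∈ Finset.range J, (1 - X ^ (2 * m + 1)))
  have h₂ := (X_pow_dvd_signedSeries_sub J J le_rfl).mul_left
    ((∏ m ∈ Finset.range J, (1 - X ^ (2 * m + 1))) *
      (∏ m ∈ Finset.range J, (1 + X ^ (2 * m + 2))))
  have h₃ : X ^ J ∣ (∏ m ∈ Finset.range J, (1 - X ^ (2 * m + 1))) *
      partitionSeries (EvenThenOdd 0) - 1 := by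
    rw [prod_mul_partitionSeries_evenThenOdd_zero]
    exact X_pow_dvd_partitionSeries_sub_one fun x _ hx => by omega
  have h₄ := h₃.mul_left (∏ m ∈ Finset.range J, (1 + X ^ (2 * m + 2)))
  have he : (∏ m ∈ Finset.range J, (1 - X ^ (2 * (2 * m + 1))) : PowerSeries ℤ) =
      (∏ m ∈ Finset.range J, (1 - X ^ (2 * m + 1))) *
        ∏ m ∈ Finset.range J, (1 + X ^ (2 * m + 1)) := by
    rw [← Finset.prod_mul_distrib]
    exact Finset.prod_congr rfl fun m _ => by ring
  rw [he]
  convert dvd_add (dvd_add h₁ h₂) h₄ using 1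
  simp only [mul_add, mul_one]
  ring

/-- The coefficients of `f` below degree `K` vanish in odd degree and are nonnegative. -/
def EvenNonneg (K : ℕ) (f : PowerSeries ℤ) : Prop :=
  ∀ n < K, (Odd n → coeff n f = 0) ∧ 0 ≤ coeff n f

theorem EvenNonneg.one (K : ℕ) : EvenNonneg K 1 := by
  intro n _
  rw [coeff_one]
  refine ⟨fun h => if_neg (by rintro rfl; simp at h), by split_ifs <;> simp⟩

theorem EvenNonneg.one_add_mul {K : ℕ} {f : PowerSeries ℤ} (hf : EvenNonneg K f) (s : ℕ) :
    EvenNonneg K ((1 + X ^ (2 * s)) * f) := by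
  intro n hn
  rw [add_mul, one_mul, map_add, coeff_X_pow_mul']
  obtain ⟨h1, h2⟩ := hf n hn
  split_ifs with h
  · obtain ⟨h3, h4⟩ := hf (n - 2 * s) (by omega)
    refine ⟨fun ho => ?_, by omega⟩
    rw [h1 ho, h3 (by rw [Nat.odd_iff] at *; omega), add_zero]
  · simpa using hf n hn

theorem EvenNonneg.of_one_sub_mul {K : ℕ} {f : PowerSeries ℤ} {s : ℕ} (hs : 0 < s)
    (hf : EvenNonneg K ((1 - X ^ (2 * s)) * f)) : EvenNonneg K f := by
  intro n
  induction n using Nat.strong_induction_on with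
  | _ n ih =>
    intro hn
    have h := hf n hn
    rw [sub_mul, one_mul, map_sub, coeff_X_pow_mul'] at h
    split_ifs at h with hsn
    · obtain ⟨h3, h4⟩ := ih (n - 2 * s) (by omega) (by omega)
      refine ⟨fun ho => ?_, by omega⟩
      have := h3 (by rw [Nat.odd_iff] at *; omega)
      have := h.1 ho
      omega
    · simpa using h

theorem EvenNonneg.of_dvd_sub {K : ℕ} {f g : PowerSeries ℤ} (hg : EvenNonneg K g)
    (h : X ^ K ∣ f - g) : EvenNonneg K f := by
  intro n hn
  have := X_pow_dvd_iff.1 h n hn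
  rw [map_sub, sub_eq_zero] at this
  rw [this]
  exact hg n hn

theorem EvenNonneg.prod_one_add (K M : ℕ) :
    EvenNonneg K (∏ m ∈ Finset.range M, (1 + X ^ (2 * (m + 1)))) := by
  induction M with
  | zero => simpa using EvenNonneg.one K
  | succ M ih =>
    rw [Finset.prod_range_succ, mul_comm]
    exact ih.one_add_mul _

theorem EvenNonneg.of_prod_one_sub_mul {K M : ℕ} {f : PowerSeries ℤ} {s : ℕ → ℕ}
    (hs : ∀ m, 0 < s m)
    (hf : EvenNonneg K ((∏ m ∈ Finset.range M, (1 - X ^ (2 * s m))) * f)) : EvenNonneg K f := by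
  induction M with
  | zero => simpa using hf
  | succ M ih =>
    rw [Finset.prod_range_succ, mul_right_comm, mul_comm] at hf
    exact ih (hf.of_one_sub_mul (hs M))

theorem EvenNonneg.coeff_pos {K : ℕ} {f : PowerSeries ℤ}
    (hf : EvenNonneg K ((1 - X ^ (2 * 1)) * f)) (h0 : 0 < coeff 0 f) {n : ℕ} (hn : 2 * n < K) :
    0 < coeff (2 * n) f := by
  induction n with
  | zero => exact h0
  | succ n ih =>
    have h := (hf (2 * (n + 1)) hn).2
    rw [sub_mul, one_mul, map_sub, coeff_X_pow_mul', if_pos (by omega),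
      show 2 * (n + 1) - 2 * 1 = 2 * n by omega] at h
    have := ih (by omega)
    omega

theorem evenNonneg_one_sub_mul_signedSeries (J : ℕ) :
    EvenNonneg (J + 1) ((1 - X ^ (2 * 1)) * signedSeries (J + 1) 0) := by
  have h := (EvenNonneg.prod_one_add (J + 1) (J + 1)).of_dvd_sub
    (X_pow_dvd_prod_mul_signedSeries_sub_prod (J + 1))
  rw [Finset.prod_range_succ', mul_assoc] at h
  exact h.of_prod_one_sub_mul (s := fun m => 2 * (m + 1) + 1) (fun m => by omega)

theorem coeff_signedSeries_zero (J N : ℕ) :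
    coeff N (signedSeries J 0) = ∑ j ∈ Finset.range J,
      (-1) ^ j * if j ≤ N then ((partitionsIn (EvenThenOdd j) (N - j)).ncard : ℤ) else 0 := by
  rw [signedSeries, map_sum]
  refine Finset.sum_congr rfl fun j _ => ?_
  have : ((-1) ^ j : PowerSeries ℤ) = C ((-1) ^ j) := by simp
  rw [this, mul_assoc, coeff_C_mul, mul_zero, zero_add, one_mul, coeff_X_pow_mul']
  simp [partitionSeries]

theorem coeff_zero_signedSeries_pos (J : ℕ) : 0 < coeff 0 (signedSeries (J + 1) 0) := by
  rw [coeff_signedSeries_zero, Finset.sum_range_succ']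
  simp [partitionsIn_zero]

theorem coeff_signedSeries_eq_zero {N : ℕ} (hN : Odd N) : coeff N (signedSeries (N + 1) 0) = 0 :=
  ((evenNonneg_one_sub_mul_signedSeries N).of_one_sub_mul one_pos N (by omega)).1 hN

theorem coeff_signedSeries_pos {N : ℕ} (hN : Even N) : 0 < coeff N (signedSeries (N + 1) 0) := by
  obtain ⟨k, rfl⟩ := hN.exists_two_nsmul
  exact (evenNonneg_one_sub_mul_signedSeries _).coeff_pos (coeff_zero_signedSeries_pos _)
    (by simp)

theorem even_lep (m : Multiset ℕ) : Even (lep m) := by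
  unfold lep
  induction m using Multiset.induction_on with
  | empty => simp
  | cons a s ih =>
    by_cases ha : Even a
    · rw [Multiset.filter_cons_of_pos _ ha, Multiset.sup_cons]
      rcases max_choice a (s.filter (fun x => Even x)).sup with h | h
      · rwa [show a ⊔ _ = a from h]
      · rwa [show a ⊔ _ = _ from h]
    · rwa [Multiset.filter_cons_of_neg _ ha]

theorem le_lep {m : Multiset ℕ} {x : ℕ} (hx : x ∈ m) (he : Even x) : x ≤ lep m :=
  Multiset.le_sup (Multiset.mem_filter.2 ⟨hx, he⟩)

theorem lep_mem {m : Multiset ℕ} (h : lep m ≠ 0) : lep m ∈ m := by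
  unfold lep at *
  induction m using Multiset.induction_on with
  | empty => simp at h
  | cons a s ih =>
    by_cases ha : Even a
    · rw [Multiset.filter_cons_of_pos _ ha, Multiset.sup_cons] at h ⊢
      rcases max_choice a (s.filter (fun x => Even x)).sup with h' | h'
      · rw [show a ⊔ _ = a from h']
        exact Multiset.mem_cons_self _ _
      · rw [show a ⊔ _ = _ from h'] at h ⊢
        exact Multiset.mem_cons_of_mem (ih h)
    · rw [Multiset.filter_cons_of_neg _ ha] at h ⊢
      exact Multiset.mem_cons_of_mem (ih h)

theorem mem_doubledWithEven {j x : ℕ} {p : Multiset ℕ} :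
    x ∈ doubledWithEven j p ↔ x ∈ p ∨ (j ≠ 0 ∧ x = 2 * j) := by
  unfold doubledWithEven
  split_ifs with h <;> simp [h, Multiset.mem_nsmul]

theorem sum_doubledWithEven (j : ℕ) (p : Multiset ℕ) :
    (doubledWithEven j p).sum = 2 * (p.sum + j) := by
  unfold doubledWithEven
  split_ifs with h <;> simp [h, Multiset.sum_nsmul]
  ring

theorem doubledWithEven_injective (j : ℕ) : Function.Injective (doubledWithEven j) := by
  intro p q h
  have h' := add_right_cancel h
  ext x
  have := congrArg (Multiset.count x) h'
  simpa using this

theorem lep_doubledWithEven {j : ℕ} {p : Multiset ℕ} (hp : ∀ x ∈ p, 0 < x ∧ EvenThenOdd j x) :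
    lep (doubledWithEven j p) = 2 * j := by
  apply le_antisymm
  · refine Multiset.sup_le.2 fun x hx => ?_
    rw [Multiset.mem_filter, mem_doubledWithEven] at hx
    rcases hx with ⟨hx | hx, he⟩
    · exact (hp x hx).2.1 he
    · exact hx.2.le
  · rcases Nat.eq_zero_or_pos j with rfl | hj
    · simp
    · exact le_lep (mem_doubledWithEven.2 (Or.inr ⟨hj.ne', rfl⟩)) (even_two_mul j)

theorem eoStar_doubledWithEven {j : ℕ} {p : Multiset ℕ}
    (hp : ∀ x ∈ p, 0 < x ∧ EvenThenOdd j x) : EOStar (doubledWithEven j p) := by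
  rw [EOStar, lep_doubledWithEven hp]
  refine ⟨fun x hx => ?_, fun x hx y hy hxe hyo => ?_, fun x _ hx => ?_, fun x hx hx' => ?_⟩
  · rcases mem_doubledWithEven.1 hx with hx | hx
    · exact (hp x hx).1
    · omega
  · have hx' := le_lep hx hxe
    rw [lep_doubledWithEven hp] at hx'
    refine hx'.trans_lt ?_
    rcases mem_doubledWithEven.1 hy with hy | hy
    · by_contra h
      exact Nat.not_even_iff_odd.2 hyo ((hp y hy).2.2 (not_lt.1 h))
    · rw [Nat.odd_iff] at hyo
      omega
  · rw [doubledWithEven, Multiset.count_add, Multiset.count_replicate, if_neg (Ne.symm hx),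
      Multiset.count_nsmul]
    simp
  · have hj : j ≠ 0 := by
      rintro rfl
      rcases mem_doubledWithEven.1 hx with h | h
      · exact (hp x h).1.ne' hx'
      · exact h.1 rfl
    rw [doubledWithEven, Multiset.count_add, Multiset.count_replicate, if_pos hx'.symm,
      Multiset.count_nsmul, if_neg hj]
    simp

theorem EOStar.exists_eq_doubledWithEven {m : Multiset ℕ} (hm : EOStar m) {j : ℕ}
    (hj : lep m = 2 * j) :
    ∃ p : Multiset ℕ, (∀ x ∈ p, 0 < x ∧ EvenThenOdd j x) ∧ m = doubledWithEven j p := by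
  obtain ⟨hpos, hlt, heven, hodd⟩ := hm
  obtain ⟨u, hu⟩ : ∃ u, m = u + Multiset.replicate (if j = 0 then 0 else 1) (2 * j) := by
    split_ifs with h
    · exact ⟨m, by simp⟩
    · refine ⟨m.erase (2 * j), ?_⟩
      have hmem : 2 * j ∈ m := hj ▸ lep_mem (by omega)
      rw [Multiset.replicate_one, add_comm, Multiset.singleton_add, Multiset.cons_erase hmem]
  have hcount : ∀ x ∈ u, 2 ∣ u.count x := by
    intro x hx
    have hxm : x ∈ m := hu ▸ Multiset.mem_add.2 (Or.inl hx)
    have hc := congrArg (Multiset.count x) hu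
    rw [Multiset.count_add, Multiset.count_replicate] at hc
    by_cases hxj : x = 2 * j
    · have := hodd x hxm (hxj.trans hj.symm)
      have := hpos x hxm
      rw [if_pos hxj.symm, if_neg (by omega)] at hc
      rw [Nat.odd_iff] at *
      omega
    · have := heven x hxm (hj ▸ hxj)
      rw [if_neg (Ne.symm hxj)] at hc
      rw [Nat.even_iff] at this
      omega
  obtain ⟨p, rfl⟩ := Multiset.exists_smul_of_dvd_count u hcount
  refine ⟨p, fun x hx => ?_, hu⟩
  have hxm : x ∈ m := hu ▸ mem_doubledWithEven.2 (Or.inl hx)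
  refine ⟨hpos x hxm, fun he => hj ▸ le_lep hxm he, fun hle => ?_⟩
  by_contra ho
  rw [Nat.not_even_iff_odd] at ho
  have hj0 : lep m ≠ 0 := by
    have := hpos x hxm
    omega
  have := hlt _ (lep_mem hj0) x hxm (even_lep m) ho
  omega

theorem EOStar.even_sum {m : Multiset ℕ} (hm : EOStar m) : Even m.sum := by
  obtain ⟨j, hj⟩ := (even_lep m).exists_two_nsmul
  obtain ⟨p, -, rfl⟩ := hm.exists_eq_doubledWithEven (j := j) (by simpa using hj)
  rw [sum_doubledWithEven]
  exact even_two_mul _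

theorem lep_le_sum (m : Multiset ℕ) : lep m ≤ m.sum := by
  by_cases h : lep m = 0
  · omega
  · exact Multiset.le_sum_of_mem (lep_mem h)

theorem setOf_eoStar_lep_eq_image {j N : ℕ} (h : j ≤ N) :
    {m : Multiset ℕ | EOStar m ∧ m.sum = 2 * N ∧ lep m = 2 * j} =
      doubledWithEven j '' partitionsIn (EvenThenOdd j) (N - j) := by
  ext m
  constructor
  · rintro ⟨hm, hs, hl⟩
    obtain ⟨p, hp, rfl⟩ := hm.exists_eq_doubledWithEven hl
    rw [sum_doubledWithEven] at hs
    exact ⟨p, ⟨hp, by omega⟩, rfl⟩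
  · rintro ⟨p, ⟨hp, hs⟩, rfl⟩
    exact ⟨eoStar_doubledWithEven hp, by rw [sum_doubledWithEven]; omega, lep_doubledWithEven hp⟩

theorem finite_setOf_eoStar (n : ℕ) : {m : Multiset ℕ | EOStar m ∧ m.sum = n}.Finite :=
  (finite_setOf_isPartition_sum_eq n).subset fun _ hm => ⟨hm.1.1, hm.2⟩

theorem ncard_sub_ncard_eq_coeff_signedSeries (N : ℕ) :
    ({m : Multiset ℕ | EOStar m ∧ m.sum = 2 * N ∧ lep m % 4 = 0}.ncard : ℤ) -
      ({m : Multiset ℕ | EOStar m ∧ m.sum = 2 * N ∧ lep m % 4 = 2}.ncard : ℤ) =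
      coeff N (signedSeries (N + 1) 0) := by
  set F := (finite_setOf_eoStar (2 * N)).toFinset with hF
  have hFm : ∀ m, m ∈ F ↔ EOStar m ∧ m.sum = 2 * N := fun m => by simp [hF]
  have hcard : ∀ (P : Multiset ℕ → Prop) [DecidablePred P],
      {m : Multiset ℕ | EOStar m ∧ m.sum = 2 * N ∧ P m}.ncard = (F.filter P).card := by
    intro P _
    rw [← Set.ncard_coe_finset]
    congr 1
    ext m
    simp [hFm, and_assoc]
  have hmaps : ∀ m ∈ F, lep m / 2 ∈ Finset.range (N + 1) := by
    intro m hm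
    have := lep_le_sum m
    rw [((hFm m).1 hm).2] at this
    rw [Finset.mem_range]
    omega
  rw [hcard, hcard, Finset.card_filter, Finset.card_filter]
  push_cast
  rw [← Finset.sum_sub_distrib]
  have hsign : ∀ m ∈ F, ((if lep m % 4 = 0 then 1 else 0) - (if lep m % 4 = 2 then 1 else 0) : ℤ) =
      (-1) ^ (lep m / 2) := by
    intro m _
    have he := Nat.even_iff.1 (even_lep m)
    rcases Nat.even_or_odd (lep m / 2) with h | h
    · rw [h.neg_one_pow]
      rw [Nat.even_iff] at h
      rw [if_pos (by omega), if_neg (by omega), sub_zero]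
    · rw [h.neg_one_pow]
      rw [Nat.odd_iff] at h
      rw [if_neg (by omega), if_pos (by omega), zero_sub]
  rw [Finset.sum_congr rfl hsign, ← Finset.sum_fiberwise_of_maps_to hmaps,
    coeff_signedSeries_zero]
  refine Finset.sum_congr rfl fun j hj => ?_
  have hjN : j ≤ N := Nat.lt_succ_iff.1 (Finset.mem_range.1 hj)
  rw [if_pos hjN, ← Set.ncard_image_of_injective _ (doubledWithEven_injective j),
    ← setOf_eoStar_lep_eq_image hjN, hcard,
    Finset.sum_congr rfl fun m hm => by rw [(Finset.mem_filter.1 hm).2],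
    Finset.sum_const, nsmul_eq_mul, mul_comm]
  congr 3
  refine Finset.filter_congr fun m _ => ?_
  have := Nat.even_iff.1 (even_lep m)
  omega

/-- Theorem 1 (partitions): `eo₀(n) = eo₂(n)` if `4 ∤ n`, and `eo₀(n) > eo₂(n)` if `4 ∣ n`. -/
theorem stmt9 (n : ℕ) (hn : 0 < n) :
    (¬ (4 ∣ n) →
      {m : Multiset ℕ | EOStar m ∧ m.sum = n ∧ lep m % 4 = 0}.ncard =
      {m : Multiset ℕ | EOStar m ∧ m.sum = n ∧ lep m % 4 = 2}.ncard) ∧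
    ((4 ∣ n) →
      {m : Multiset ℕ | EOStar m ∧ m.sum = n ∧ lep m % 4 = 2}.ncard <
      {m : Multiset ℕ | EOStar m ∧ m.sum = n ∧ lep m % 4 = 0}.ncard) := by
  rcases Nat.even_or_odd n with he | ho
  · obtain ⟨N, rfl⟩ := he.exists_two_nsmul
    rw [smul_eq_mul]
    have h := ncard_sub_ncard_eq_coeff_signedSeries N
    refine ⟨fun h4 => ?_, fun h4 => ?_⟩
    · rw [coeff_signedSeries_eq_zero (Nat.odd_iff.2 (by omega))] at h
      omega
    · have := coeff_signedSeries_pos (N := N) (Nat.even_iff.2 (by omega))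
      omega
  · rw [Nat.odd_iff] at ho
    have hempty : ∀ r : ℕ, {m : Multiset ℕ | EOStar m ∧ m.sum = n ∧ lep m % 4 = r} = ∅ := by
      refine fun r => Set.eq_empty_iff_forall_notMem.2 fun m hm => ?_
      have := Nat.even_iff.1 hm.1.even_sum
      rw [hm.2.1] at this
      omega
    exact ⟨fun _ => by rw [hempty, hempty], fun h4 => by omega⟩
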